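/- Fix γ > 0, T > 0, and bounds μ, ρ, ν > 0. There exists C ≥ 1, depending only on γ, T, μ, ρ, ν (and independent of ε), such that the following holds for every ε ∈ (0,1]: if ξ, η : [0,T] × ℝ → ℝ are continuous in t and smooth mean-zero 2π-periodic in x with sup_{0≤t≤T} ‖ξ(t,·)‖_{H⁵} ≤ ρ and sup_{0≤t≤T} ‖η(t,·)‖_{H²} ≤ ν, and v is a smooth solution on [0,T] of the regularized equation ∂_t v + γ v + ∂_x³ v + ∂_x(ξ v) + v ∂_x v + ε ∂_x⁴ v = η with ‖v(0,·)‖_{L²} + ‖v(0,·)‖_{H²} ≤ μ, then sup_{0≤t≤T} ‖v(t,·)‖_{H²} + ε^{1/2} ( ∫₀^T ‖v(t,·)‖_{H⁴}² dt )^{1/2} ≤ C. -/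

import Mathlib

open MeasureTheory Real Filter Topology

noncomputable section

/-- A smooth, mean-zero, `2π`-periodic function `v : ℝ → ℝ`. -/
def SmoothMeanZeroPeriodic (v : ℝ → ℝ) : Prop :=
  ContDiff ℝ (⊤ : ℕ∞) v ∧ (∀ x : ℝ, v (x + 2 * Real.pi) = v x) ∧
    (∫ x in (0:ℝ)..(2 * Real.pi), v x) = 0

/-- The `L²` norm over one period: `(∫₀^{2π} |v|²)^{1/2}`. -/
def L2norm (v : ℝ → ℝ) : ℝ := Real.sqrt (∫ x in (0:ℝ)..(2 * Real.pi), (v x) ^ 2)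

/-- The homogeneous Sobolev norm `‖v‖_{H^m} = ‖D^m v‖_{L²}`. -/
def Hnorm (m : ℕ) (v : ℝ → ℝ) : ℝ := L2norm (iteratedDeriv m v)

/-- Time-dependent data on `[0,T]`: continuous in `t`, smooth mean-zero `2π`-periodic
in `x`, with `H^k` norm bounded by `ρ` for each `t ∈ [0,T]`. -/
def RegData (T : ℝ) (k : ℕ) (ρ : ℝ) (ξ : ℝ → ℝ → ℝ) : Prop :=
  (∀ x : ℝ, Continuous fun t => ξ t x) ∧
  (∀ t : ℝ, 0 ≤ t → t ≤ T → SmoothMeanZeroPeriodic (ξ t)) ∧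
  (∀ t : ℝ, 0 ≤ t → t ≤ T → Hnorm k (ξ t) ≤ ρ)

/-- A smooth solution on `[0,T]` of the regularized equation
`∂ₜv + γv + ∂ₓ³v + ∂ₓ(ξ v) + v ∂ₓv + ε ∂ₓ⁴v = η`,
mean-zero `2π`-periodic in `x`. -/
def IsRegSol (γ ε T : ℝ) (ξ η v : ℝ → ℝ → ℝ) : Prop :=
  ContDiff ℝ (⊤ : ℕ∞) (fun p : ℝ × ℝ => v p.1 p.2) ∧
  (∀ t : ℝ, 0 ≤ t → t ≤ T → SmoothMeanZeroPeriodic (v t)) ∧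
  (∀ t x : ℝ, 0 ≤ t → t ≤ T →
    deriv (fun s => v s x) t + γ * v t x + iteratedDeriv 3 (v t) x
      + deriv (fun y => ξ t y * v t y) x + v t x * deriv (v t) x
      + ε * iteratedDeriv 4 (v t) x = η t x)


/-! ### Functions of time and space -/

theorem contDiff_deriv_snd {f : ℝ → ℝ → ℝ}
    (hf : ContDiff ℝ (⊤ : ℕ∞) fun p : ℝ × ℝ => f p.1 p.2) :
    ContDiff ℝ (⊤ : ℕ∞) fun p : ℝ × ℝ => deriv (f p.1) p.2 := by
  have h : ContDiff ℝ (⊤ : ℕ∞) fun p : ℝ × ℝ => fderiv ℝ (f p.1) p.2 :=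
    ContDiff.fderiv (f := fun p : ℝ × ℝ => f p.1) (m := (⊤ : ℕ∞))
      (hf.comp (contDiff_fst.fst.prodMk contDiff_snd)) contDiff_snd (by simp)
  exact h.clm_apply contDiff_const

theorem contDiff_deriv_fst {f : ℝ → ℝ → ℝ}
    (hf : ContDiff ℝ (⊤ : ℕ∞) fun p : ℝ × ℝ => f p.1 p.2) :
    ContDiff ℝ (⊤ : ℕ∞) fun p : ℝ × ℝ => deriv (fun s => f s p.2) p.1 :=
  (contDiff_deriv_snd (f := fun x t => f t x) (hf.comp (contDiff_snd.prodMk contDiff_fst))).comp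
    (contDiff_snd.prodMk contDiff_fst)

theorem contDiff_iteratedDeriv_snd {f : ℝ → ℝ → ℝ}
    (hf : ContDiff ℝ (⊤ : ℕ∞) fun p : ℝ × ℝ => f p.1 p.2) (k : ℕ) :
    ContDiff ℝ (⊤ : ℕ∞) fun p : ℝ × ℝ => iteratedDeriv k (f p.1) p.2 := by
  induction k with
  | zero => simpa using hf
  | succ k ih =>
    simp only [iteratedDeriv_succ]
    exact contDiff_deriv_snd (f := fun t => iteratedDeriv k (f t)) ih

theorem hasDerivAt_fst_deriv {f : ℝ → ℝ → ℝ}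
    (hf : ContDiff ℝ (⊤ : ℕ∞) fun p : ℝ × ℝ => f p.1 p.2) (t x : ℝ) :
    HasDerivAt (fun s => f s x) (deriv (fun s => f s x) t) t := by
  have h : ContDiff ℝ (⊤ : ℕ∞) fun s => f s x :=
    hf.comp (contDiff_id.prodMk contDiff_const)
  exact (h.differentiable (by simp) t).hasDerivAt

theorem deriv_fst_eq_fderiv {f : ℝ → ℝ → ℝ}
    (hf : ContDiff ℝ (⊤ : ℕ∞) fun p : ℝ × ℝ => f p.1 p.2) (t x : ℝ) :
    deriv (fun s => f s x) t = fderiv ℝ (fun p : ℝ × ℝ => f p.1 p.2) (t, x) (1, 0) := by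
  have h := ((hf.differentiable (by simp)) (t, x)).hasFDerivAt.comp_hasDerivAt t
    ((hasDerivAt_id t).prodMk (hasDerivAt_const t x))
  exact h.deriv

theorem deriv_snd_eq_fderiv {f : ℝ → ℝ → ℝ}
    (hf : ContDiff ℝ (⊤ : ℕ∞) fun p : ℝ × ℝ => f p.1 p.2) (t x : ℝ) :
    deriv (f t) x = fderiv ℝ (fun p : ℝ × ℝ => f p.1 p.2) (t, x) (0, 1) := by
  have h := ((hf.differentiable (by simp)) (t, x)).hasFDerivAt.comp_hasDerivAt x
    ((hasDerivAt_const x t).prodMk (hasDerivAt_id x))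
  exact h.deriv

theorem deriv_fst_deriv_snd_comm {f : ℝ → ℝ → ℝ}
    (hf : ContDiff ℝ (⊤ : ℕ∞) fun p : ℝ × ℝ => f p.1 p.2) (t x : ℝ) :
    deriv (fun s => deriv (f s) x) t = deriv (fun y => deriv (fun s => f s y) t) x := by
  set F : ℝ × ℝ → ℝ := fun p => f p.1 p.2 with hF
  have hsymm : IsSymmSndFDerivAt ℝ F (t, x) := hf.contDiffAt.isSymmSndFDerivAt (by
    rw [minSmoothness_of_isRCLikeNormedField]
    exact WithTop.coe_le_coe.2 le_top)
  have hd : DifferentiableAt ℝ (fderiv ℝ F) (t, x) :=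
    (hf.fderiv_right (m := (⊤ : ℕ∞)) (by simp)).differentiable (by simp) _
  rw [deriv_fst_eq_fderiv (f := fun s y => deriv (f s) y) (contDiff_deriv_snd hf),
    deriv_snd_eq_fderiv (f := fun s y => deriv (fun r => f r y) s) (contDiff_deriv_fst hf)]
  have h1 : (fun p : ℝ × ℝ => deriv (f p.1) p.2) = fun p => fderiv ℝ F p (0, 1) :=
    funext fun p => deriv_snd_eq_fderiv hf p.1 p.2
  have h2 : (fun p : ℝ × ℝ => deriv (fun s => f s p.2) p.1) = fun p => fderiv ℝ F p (1, 0) :=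
    funext fun p => deriv_fst_eq_fderiv hf p.1 p.2
  rw [h1, h2, fderiv_clm_apply hd (by fun_prop), fderiv_clm_apply hd (by fun_prop)]
  simpa using hsymm.eq (1, 0) (0, 1)

theorem hasDerivAt_fst_iteratedDeriv {f : ℝ → ℝ → ℝ}
    (hf : ContDiff ℝ (⊤ : ℕ∞) fun p : ℝ × ℝ => f p.1 p.2) (k : ℕ) (t x : ℝ) :
    HasDerivAt (fun s => iteratedDeriv k (f s) x)
      (iteratedDeriv k (fun y => deriv (fun s => f s y) t) x) t := by
  induction k generalizing f with
  | zero => simpa using hasDerivAt_fst_deriv hf t x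
  | succ k ih =>
    have h := ih (f := fun s => deriv (f s)) (contDiff_deriv_snd hf)
    simp only [iteratedDeriv_succ']
    simpa only [deriv_fst_deriv_snd_comm hf] using h

theorem hasDerivAt_intervalIntegral_of_contDiff {f : ℝ → ℝ → ℝ}
    (hf : ContDiff ℝ (⊤ : ℕ∞) fun p : ℝ × ℝ => f p.1 p.2) (a b t : ℝ) :
    HasDerivAt (fun s => ∫ x in a..b, f s x) (∫ x in a..b, deriv (fun s => f s x) t) t := by
  have hc := (contDiff_deriv_fst hf).continuous
  obtain ⟨B, hB⟩ := ((isCompact_closedBall t 1).prod (isCompact_uIcc (a := a) (b := b))).exists_bound_of_continuousOn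
    hc.continuousOn
  have hcx : ∀ s, Continuous (f s) := fun s =>
    hf.continuous.comp (by fun_prop : Continuous fun x : ℝ => (s, x))
  refine (intervalIntegral.hasDerivAt_integral_of_dominated_loc_of_deriv_le
    (F := f) (F' := fun s x => deriv (fun r => f r x) s) (bound := fun _ => B)
    (Metric.closedBall_mem_nhds t one_pos)
    (Eventually.of_forall fun s => (hcx s).aestronglyMeasurable)
    ((hcx t).intervalIntegrable a b) ?_ ?_ intervalIntegrable_const ?_).2
  · exact (hc.comp (by fun_prop : Continuous fun x : ℝ => (t, x))).aestronglyMeasurable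
  · refine Eventually.of_forall fun x hx s hs => hB (s, x) ⟨hs, Set.uIoc_subset_uIcc hx⟩
  · exact Eventually.of_forall fun x _ s _ => hasDerivAt_fst_deriv hf s x

/-- Gronwall's inequality with a dissipation term. -/
theorem add_integral_le_exp_mul {f f' g : ℝ → ℝ} {A T : ℝ} (hA : 0 ≤ A)
    (hf : ∀ t, 0 ≤ t → t ≤ T → HasDerivAt f (f' t) t) (hg : Continuous g) (hg0 : ∀ t, 0 ≤ g t)
    (h : ∀ t, 0 ≤ t → t ≤ T → f' t ≤ A * f t - g t) {t : ℝ} (ht0 : 0 ≤ t) (htT : t ≤ T) :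
    f t + ∫ s in (0 : ℝ)..t, g s ≤ Real.exp (A * t) * f 0 := by
  set h' : ℝ → ℝ := fun t => Real.exp (-(A * t)) * (f t + ∫ s in (0 : ℝ)..t, g s) with hh'
  have hd : ∀ t, 0 ≤ t → t ≤ T → HasDerivAt h'
      (Real.exp (-(A * t)) * -(A * 1) * (f t + ∫ s in (0 : ℝ)..t, g s)
        + Real.exp (-(A * t)) * (f' t + g t)) t := by
    intro t h0 h1
    exact (((hasDerivAt_id t).const_mul A).neg.exp).mul
      ((hf t h0 h1).add (intervalIntegral.integral_hasDerivAt_right (hg.intervalIntegrable _ _)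
        hg.aestronglyMeasurable.stronglyMeasurableAtFilter hg.continuousAt))
  have hanti : AntitoneOn h' (Set.Icc 0 T) := by
    refine antitoneOn_of_deriv_nonpos (convex_Icc 0 T)
      (fun s hs => (hd s hs.1 hs.2).continuousAt.continuousWithinAt) ?_ ?_
    · intro s hs
      have hs := interior_subset hs
      exact (hd s hs.1 hs.2).differentiableAt.differentiableWithinAt
    · intro s hs
      have hs := interior_subset hs
      rw [(hd s hs.1 hs.2).deriv]
      have h1 := h s hs.1 hs.2
      have h2 : 0 ≤ ∫ r in (0 : ℝ)..s, g r :=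
        intervalIntegral.integral_nonneg hs.1 fun r _ => hg0 r
      have h3 := mul_nonneg hA h2
      have h4 := Real.exp_pos (-(A * s))
      nlinarith [mul_nonneg h4.le (by linarith : 0 ≤ A * (f s + ∫ r in (0 : ℝ)..s, g r) - (f' s + g s))]
  have h0 := hanti ⟨le_rfl, ht0.trans htT⟩ ⟨ht0, htT⟩ ht0
  simp only [hh', mul_zero, neg_zero, Real.exp_zero, one_mul, intervalIntegral.integral_same,
    add_zero] at h0
  calc f t + ∫ s in (0 : ℝ)..t, g s
      = Real.exp (A * t) * (Real.exp (-(A * t)) * (f t + ∫ s in (0 : ℝ)..t, g s)) := by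
        rw [← mul_assoc, ← Real.exp_add]; simp
    _ ≤ _ := by gcongr

/-! ### Smooth mean-zero periodic functions -/

theorem L2norm_nonneg (f : ℝ → ℝ) : 0 ≤ L2norm f := Real.sqrt_nonneg _

theorem L2norm_sq (f : ℝ → ℝ) : L2norm f ^ 2 = ∫ x in (0 : ℝ)..(2 * Real.pi), f x ^ 2 :=
  Real.sq_sqrt (intervalIntegral.integral_nonneg Real.two_pi_pos.le fun _ _ => sq_nonneg _)

theorem integral_mul_le_L2norm {f g : ℝ → ℝ} (hf : Continuous f) (hg : Continuous g) :
    ∫ x in (0 : ℝ)..(2 * Real.pi), f x * g x ≤ L2norm f * L2norm g := by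
  refine abs_le_of_sq_le_sq' ?_ (mul_nonneg (L2norm_nonneg f) (L2norm_nonneg g)) |>.2
  have hd : ∀ s : ℝ, 0 ≤ L2norm g ^ 2 * (s * s)
      + (2 * ∫ x in (0 : ℝ)..(2 * Real.pi), f x * g x) * s + L2norm f ^ 2 := by
    intro s
    have h0 : 0 ≤ ∫ x in (0 : ℝ)..(2 * Real.pi), (f x + s * g x) ^ 2 :=
      intervalIntegral.integral_nonneg Real.two_pi_pos.le fun _ _ => sq_nonneg _
    have h1 : ∫ x in (0 : ℝ)..(2 * Real.pi), (f x + s * g x) ^ 2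
        = ∫ x in (0 : ℝ)..(2 * Real.pi), (f x ^ 2 + 2 * s * (f x * g x) + s ^ 2 * g x ^ 2) := by
      congr 1; ext x; ring
    rw [h1, intervalIntegral.integral_add (Continuous.intervalIntegrable (by fun_prop) _ _)
      (Continuous.intervalIntegrable (by fun_prop) _ _),
      intervalIntegral.integral_add (Continuous.intervalIntegrable (by fun_prop) _ _)
      (Continuous.intervalIntegrable (by fun_prop) _ _), intervalIntegral.integral_const_mul,
      intervalIntegral.integral_const_mul, ← L2norm_sq, ← L2norm_sq] at h0
    linarith
  have := discrim_le_zero hd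
  rw [discrim] at this
  nlinarith

theorem SmoothMeanZeroPeriodic.continuous {f : ℝ → ℝ} (hf : SmoothMeanZeroPeriodic f) :
    Continuous f := hf.1.continuous

theorem SmoothMeanZeroPeriodic.hasDerivAt {f : ℝ → ℝ} (hf : SmoothMeanZeroPeriodic f) (x : ℝ) :
    HasDerivAt f (deriv f x) x := (hf.1.differentiable (by simp) x).hasDerivAt

theorem SmoothMeanZeroPeriodic.apply_two_pi {f : ℝ → ℝ} (hf : SmoothMeanZeroPeriodic f) :
    f (2 * Real.pi) = f 0 := by simpa using hf.2.1 0

theorem periodic_deriv {f : ℝ → ℝ} {c : ℝ} (hf : Function.Periodic f c) :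
    Function.Periodic (deriv f) c := fun x => by
  rw [← deriv_comp_add_const]
  exact congrArg (fun g => deriv g x) (funext hf)

theorem SmoothMeanZeroPeriodic.deriv {f : ℝ → ℝ} (hf : SmoothMeanZeroPeriodic f) :
    SmoothMeanZeroPeriodic (deriv f) := by
  have hs : ContDiff ℝ (⊤ : ℕ∞) (_root_.deriv f) := (contDiff_infty_iff_deriv.1 hf.1).2
  refine ⟨hs, periodic_deriv hf.2.1, ?_⟩
  rw [intervalIntegral.integral_eq_sub_of_hasDerivAt (fun x _ => hf.hasDerivAt x)
    (hs.continuous.intervalIntegrable _ _), hf.apply_two_pi, sub_self]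

theorem SmoothMeanZeroPeriodic.iteratedDeriv {f : ℝ → ℝ} (hf : SmoothMeanZeroPeriodic f) (k : ℕ) :
    SmoothMeanZeroPeriodic (iteratedDeriv k f) := by
  induction k with
  | zero => simpa using hf
  | succ k ih => rw [iteratedDeriv_succ]; exact ih.deriv

theorem SmoothMeanZeroPeriodic.exists_eq_zero {f : ℝ → ℝ} (hf : SmoothMeanZeroPeriodic f) :
    ∃ x ∈ Set.Icc 0 (2 * Real.pi), f x = 0 := by
  obtain ⟨x, hx, h⟩ := exists_eq_interval_average (f := f) (a := 0) (b := 2 * Real.pi)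
    Real.two_pi_pos.ne hf.continuous.continuousOn
  rw [interval_average_eq, hf.2.2, smul_zero] at h
  rw [Set.uIoo_of_le Real.two_pi_pos.le] at hx
  exact ⟨x, Set.Ioo_subset_Icc_self hx, h⟩

/-- Agmon's inequality for mean-zero periodic functions. -/
theorem SmoothMeanZeroPeriodic.sq_le {f : ℝ → ℝ} (hf : SmoothMeanZeroPeriodic f) (x : ℝ) :
    f x ^ 2 ≤ 2 * L2norm f * L2norm (_root_.deriv f) := by
  obtain ⟨y, hy, hxy⟩ := Function.Periodic.exists_mem_Ico₀ (f := f) hf.2.1 Real.two_pi_pos x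
  obtain ⟨z, hz, hz0⟩ := hf.exists_eq_zero
  have hc := hf.continuous
  have hc' := hf.deriv.continuous
  have hint : ∫ s in z..y, 2 * f s * _root_.deriv f s = f y ^ 2 := by
    rw [intervalIntegral.integral_eq_sub_of_hasDerivAt (f := fun s => f s ^ 2)
      (fun s _ => ((hf.hasDerivAt s).fun_pow 2).congr_deriv (by simp))
      (Continuous.intervalIntegrable (by fun_prop) _ _), hz0]
    ring
  have habs : ∀ g : ℝ → ℝ, L2norm (fun s => |g s|) = L2norm g := by
    intro g; simp [L2norm]
  calc f x ^ 2 = |∫ s in z..y, 2 * f s * _root_.deriv f s| := by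
        rw [hint, hxy, abs_of_nonneg (sq_nonneg _)]
    _ ≤ abs (∫ s in z..y, |2 * f s * _root_.deriv f s|) := by
        simpa only [Real.norm_eq_abs] using intervalIntegral.norm_integral_le_abs_integral_norm
          (f := fun s => 2 * f s * _root_.deriv f s)
    _ ≤ abs (∫ s in (0 : ℝ)..(2 * Real.pi), |2 * f s * _root_.deriv f s|) := by
        refine intervalIntegral.abs_integral_mono_interval ?_ ?_ 
          (Continuous.intervalIntegrable (by fun_prop) _ _)
        · rw [Set.uIoc_of_le Real.two_pi_pos.le]
          rintro s hs
          rw [Set.mem_uIoc] at hs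
          rcases hs with hs | hs
          · exact ⟨hz.1.trans_lt hs.1, hs.2.trans hy.2.le⟩
          · exact ⟨hy.1.trans_lt hs.1, hs.2.trans hz.2⟩
        · exact Eventually.of_forall fun s => abs_nonneg _
    _ = 2 * ∫ s in (0 : ℝ)..(2 * Real.pi), |f s| * |_root_.deriv f s| := by
        rw [abs_of_nonneg (intervalIntegral.integral_nonneg Real.two_pi_pos.le
          fun _ _ => abs_nonneg _), ← intervalIntegral.integral_const_mul]
        simp [abs_mul, mul_assoc]
    _ ≤ 2 * (L2norm f * L2norm (_root_.deriv f)) := by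
        rw [← habs f, ← habs (_root_.deriv f)]
        gcongr
        exact integral_mul_le_L2norm hc.abs hc'.abs
    _ = _ := by ring

/-- Poincaré's inequality for mean-zero periodic functions. -/
theorem SmoothMeanZeroPeriodic.L2norm_le {f : ℝ → ℝ} (hf : SmoothMeanZeroPeriodic f) :
    L2norm f ≤ 4 * Real.pi * L2norm (_root_.deriv f) := by
  have h : L2norm f ^ 2 ≤ ∫ _ in (0 : ℝ)..(2 * Real.pi), 2 * L2norm f * L2norm (_root_.deriv f) := by
    rw [L2norm_sq]
    have hc := hf.continuous
    exact intervalIntegral.integral_mono Real.two_pi_pos.le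
      (Continuous.intervalIntegrable (by fun_prop) _ _) intervalIntegrable_const hf.sq_le
  rw [intervalIntegral.integral_const, smul_eq_mul, sub_zero] at h
  rcases (L2norm_nonneg f).eq_or_lt with h0 | h0
  · rw [← h0]
    exact mul_nonneg (by positivity) (L2norm_nonneg _)
  · nlinarith

theorem SmoothMeanZeroPeriodic.L2norm_le_Hnorm {f : ℝ → ℝ} (hf : SmoothMeanZeroPeriodic f) (k : ℕ) :
    L2norm f ≤ (4 * Real.pi) ^ k * Hnorm k f := by
  induction k with
  | zero => simp [Hnorm]
  | succ k ih =>
    refine ih.trans ?_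
    rw [pow_succ, mul_assoc]
    gcongr
    rw [Hnorm, Hnorm, iteratedDeriv_succ]
    exact (hf.iteratedDeriv k).L2norm_le

/-- Sobolev embedding: derivatives of order below `m` are bounded by the `H^m` norm. -/
theorem SmoothMeanZeroPeriodic.abs_iteratedDeriv_le {f : ℝ → ℝ} (hf : SmoothMeanZeroPeriodic f)
    {j m : ℕ} (hjm : j < m) (x : ℝ) :
    |_root_.iteratedDeriv j f x| ≤ (4 * Real.pi) ^ m * Hnorm m f := by
  have hpi : 1 ≤ 4 * Real.pi := by linarith [Real.pi_gt_three]
  have key : ∀ i ≤ m, L2norm (_root_.iteratedDeriv i f) ≤ (4 * Real.pi) ^ (m - i) * Hnorm m f := by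
    intro i hi
    have h := (hf.iteratedDeriv i).L2norm_le_Hnorm (m - i)
    have h2 : Hnorm (m - i) (_root_.iteratedDeriv i f) = Hnorm m f := by
      rw [Hnorm, Hnorm, iteratedDeriv_eq_iterate, iteratedDeriv_eq_iterate, iteratedDeriv_eq_iterate,
        ← Function.iterate_add_apply, Nat.sub_add_cancel hi]
    rwa [h2] at h
  have h0 := key j hjm.le
  have h1 := key (j + 1) hjm
  have h2 := (hf.iteratedDeriv j).sq_le x
  rw [← iteratedDeriv_succ] at h2
  obtain ⟨n, rfl⟩ : ∃ n, m = j + 1 + n := ⟨m - (j + 1), by omega⟩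
  have e0 : j + 1 + n - j = n + 1 := by omega
  have e1 : j + 1 + n - (j + 1) = n := by omega
  rw [e0] at h0
  rw [e1] at h1
  set H := Hnorm (j + 1 + n) f with hH
  have hH0 : 0 ≤ H := L2norm_nonneg _
  have hp : 0 ≤ (4 * Real.pi) ^ n := by positivity
  have h3 : (4 * Real.pi) ^ (n + 1) ≤ (4 * Real.pi) ^ (j + 1 + n) :=
    pow_le_pow_right₀ hpi (by omega)
  refine (?_ : _ ≤ (4 * Real.pi) ^ (n + 1) * H).trans (by gcongr)
  refine abs_le_of_sq_le_sq ?_ (by positivity)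
  calc _ ≤ 2 * L2norm (_root_.iteratedDeriv j f) * L2norm (_root_.iteratedDeriv (j + 1) f) := h2
    _ ≤ 2 * ((4 * Real.pi) ^ (n + 1) * H) * ((4 * Real.pi) ^ n * H) := by
        gcongr
        exact L2norm_nonneg _
    _ ≤ (4 * Real.pi) * ((4 * Real.pi) ^ (n + 1) * H) * ((4 * Real.pi) ^ n * H) := by
        gcongr
        linarith [Real.pi_gt_three]
    _ = _ := by ring

/-! ### Energy identities at a fixed time -/

/-- A sequence of functions, each the derivative of the previous one, taking equal values at `0`
and `2π`. -/
structure PeriodicJet (u : ℕ → ℝ → ℝ) : Prop where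
  hasDerivAt : ∀ k x, HasDerivAt (u k) (u (k + 1) x) x
  apply_two_pi : ∀ k, u k (2 * Real.pi) = u k 0

theorem PeriodicJet.continuous {u : ℕ → ℝ → ℝ} (hu : PeriodicJet u) (k : ℕ) :
    Continuous (u k) :=
  continuous_iff_continuousAt.2 fun x => (hu.hasDerivAt k x).continuousAt

theorem periodicJet_iteratedDeriv {f : ℝ → ℝ} (hf : ContDiff ℝ (⊤ : ℕ∞) f)
    (hp : Function.Periodic f (2 * Real.pi)) : PeriodicJet fun k => iteratedDeriv k f where
  hasDerivAt k x := by
    rw [iteratedDeriv_succ]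
    exact (hf.differentiable_iteratedDeriv k (WithTop.coe_lt_coe.2 (ENat.natCast_lt_top k)) x).hasDerivAt
  apply_two_pi k := by
    have h : Function.Periodic (iteratedDeriv k f) (2 * Real.pi) := by
      induction k with
      | zero => simpa using hp
      | succ k ih => rw [iteratedDeriv_succ]; exact periodic_deriv ih
    simpa using h 0

theorem integral_eq_of_hasDerivAt_sub {f g q : ℝ → ℝ} (hf : Continuous f) (hg : Continuous g)
    (hq : ∀ x, HasDerivAt q (f x - g x) x) (h : q (2 * Real.pi) = q 0) :
    ∫ x in (0 : ℝ)..(2 * Real.pi), f x = ∫ x in (0 : ℝ)..(2 * Real.pi), g x := by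
  have h1 := intervalIntegral.integral_eq_sub_of_hasDerivAt (a := 0) (b := 2 * Real.pi)
    (fun x _ => hq x) (Continuous.intervalIntegrable (by fun_prop) _ _)
  rw [intervalIntegral.integral_sub (hf.intervalIntegrable _ _) (hg.intervalIntegrable _ _), h,
    sub_self] at h1
  exact sub_eq_zero.1 h1

section Identities

variable {γ ε : ℝ} {u w ξ η : ℕ → ℝ → ℝ}

theorem integral_L2_energy (hu : PeriodicJet u) (hw : PeriodicJet w) (hξ : PeriodicJet ξ)
    (hη : PeriodicJet η)
    (h : ∀ x, w 0 x + γ * u 0 x + u 3 x + (ξ 1 x * u 0 x + ξ 0 x * u 1 x) + u 0 x * u 1 x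
      + ε * u 4 x = η 0 x) :
    ∫ x in (0 : ℝ)..(2 * Real.pi), 2 * u 0 x * w 0 x
      = ∫ x in (0 : ℝ)..(2 * Real.pi), (2 * u 0 x * η 0 x - 2 * γ * u 0 x ^ 2
          - ξ 1 x * u 0 x ^ 2 - 2 * ε * u 2 x ^ 2) := by
  have cu := hu.continuous
  have cw := hw.continuous
  have cξ := hξ.continuous
  have cη := hη.continuous
  refine integral_eq_of_hasDerivAt_sub (q := fun x => -(2 * (u 0 x * u 2 x)) + u 1 x ^ 2
    - ξ 0 x * u 0 x ^ 2 - 2 / 3 * u 0 x ^ 3 - 2 * ε * (u 0 x * u 3 x - u 1 x * u 2 x))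
    (by fun_prop) (by fun_prop) (fun x => ?_) ?_
  · have d := fun k => hu.hasDerivAt k x
    have dξ := fun k => hξ.hasDerivAt k x
    refine (((((((d 0).mul (d 2)).const_mul 2).neg.add ((d 1).fun_pow 2)).sub
      ((dξ 0).mul ((d 0).fun_pow 2))).sub (((d 0).fun_pow 3).const_mul (2 / 3))).sub
      ((((d 0).mul (d 3)).sub ((d 1).mul (d 2))).const_mul (2 * ε))).congr_deriv ?_
    norm_num
    linear_combination (-2 * u 0 x) * h x
  · simp only [hu.apply_two_pi, hξ.apply_two_pi]

theorem integral_H2_energy (hu : PeriodicJet u) (hw : PeriodicJet w) (hξ : PeriodicJet ξ)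
    (hη : PeriodicJet η)
    (h : ∀ x, w 0 x + γ * u 0 x + u 3 x + (ξ 1 x * u 0 x + ξ 0 x * u 1 x) + u 0 x * u 1 x
      + ε * u 4 x = η 0 x) :
    ∫ x in (0 : ℝ)..(2 * Real.pi),
        (2 * u 2 x * w 2 x - 5 / 3 * (w 0 x * u 1 x ^ 2 + u 0 x * (2 * u 1 x * w 1 x)))
      = ∫ x in (0 : ℝ)..(2 * Real.pi),
        (2 * η 2 x * u 2 x + 5 / 3 * η 0 x * (u 1 x ^ 2 + 2 * u 0 x * u 2 x)
          - 2 * γ * u 2 x ^ 2 + 5 * γ * u 0 x * u 1 x ^ 2 + 5 / 3 * u 0 x * u 1 x ^ 3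
          - 2 * ξ 3 x * u 0 x * u 2 x - 6 * ξ 2 x * u 1 x * u 2 x - 5 * ξ 1 x * u 2 x ^ 2
          - 10 / 3 * ξ 1 x * u 0 x ^ 2 * u 2 x
          - 2 * ε * u 4 x ^ 2 - 5 / 3 * ε * u 4 x * (u 1 x ^ 2 + 2 * u 0 x * u 2 x)) := by
  have cu := hu.continuous
  have cw := hw.continuous
  have cξ := hξ.continuous
  have cη := hη.continuous
  refine integral_eq_of_hasDerivAt_sub (q := fun x =>
      2 * (u 2 x * w 1 x) - 2 * (u 3 x * w 0 x) - 10 / 3 * (u 0 x * u 1 x * w 0 x)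
      + 2 * (η 0 x * u 3 x) - 2 * (η 1 x * u 2 x)
      - 2 * γ * (u 0 x * u 3 x - u 1 x * u 2 x) - 10 / 3 * γ * (u 0 x ^ 2 * u 1 x)
      - u 3 x ^ 2 + 1 / 3 * (u 2 x * u 1 x ^ 2) - 2 / 3 * (u 0 x * u 2 x ^ 2)
      - 2 * (u 0 x * u 1 x * u 3 x) - 5 / 3 * (u 0 x ^ 2 * u 1 x ^ 2)
      - 2 * ((ξ 1 x * u 0 x + ξ 0 x * u 1 x) * u 3 x)
      + 2 * ((ξ 2 x * u 0 x + 2 * (ξ 1 x * u 1 x) + ξ 0 x * u 2 x) * u 2 x)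
      - ξ 0 x * u 2 x ^ 2 - 5 / 3 * (ξ 0 x * u 0 x * u 1 x ^ 2))
    (by fun_prop) (by fun_prop) (fun x => ?_) ?_
  · have d := fun k => hu.hasDerivAt k x
    have dw := fun k => hw.hasDerivAt k x
    have dη := fun k => hη.hasDerivAt k x
    have dξ := fun k => hξ.hasDerivAt k x
    have d1 := ((((d 2).fun_mul (dw 1)).const_mul 2).fun_sub (((d 3).fun_mul (dw 0)).const_mul 2)).fun_sub
      ((((d 0).fun_mul (d 1)).fun_mul (dw 0)).const_mul (10 / 3))
    have d2 := (((dη 0).fun_mul (d 3)).const_mul 2)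
    have d3 := (((dη 1).fun_mul (d 2)).const_mul 2)
    have d4 := (((d 0).fun_mul (d 3)).fun_sub ((d 1).fun_mul (d 2))).const_mul (2 * γ)
    have d5 := ((((d 0).fun_pow 2).fun_mul (d 1))).const_mul (10 / 3 * γ)
    have d6 := (d 3).fun_pow 2
    have d7 := ((d 2).fun_mul ((d 1).fun_pow 2)).const_mul (1 / 3)
    have d8 := ((d 0).fun_mul ((d 2).fun_pow 2)).const_mul (2 / 3)
    have d9 := (((d 0).fun_mul (d 1)).fun_mul (d 3)).const_mul 2
    have d10 := (((d 0).fun_pow 2).fun_mul ((d 1).fun_pow 2)).const_mul (5 / 3)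
    have d11 := ((((dξ 1).fun_mul (d 0)).fun_add ((dξ 0).fun_mul (d 1))).fun_mul (d 3)).const_mul 2
    have d12 := (((((dξ 2).fun_mul (d 0)).fun_add (((dξ 1).fun_mul (d 1)).const_mul 2)).fun_add
      ((dξ 0).fun_mul (d 2))).fun_mul (d 2)).const_mul 2
    have d13 := (dξ 0).fun_mul ((d 2).fun_pow 2)
    have d14 := (((dξ 0).fun_mul (d 0)).fun_mul ((d 1).fun_pow 2)).const_mul (5 / 3)
    refine (((((((((((((d1.fun_add d2).fun_sub d3).fun_sub d4).fun_sub d5).fun_sub d6).fun_add d7).fun_sub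
      d8).fun_sub d9).fun_sub d10).fun_sub d11).fun_add d12).fun_sub d13).fun_sub d14).congr_deriv ?_
    norm_num
    linear_combination (-(2 * u 4 x + 5 / 3 * (u 1 x ^ 2 + 2 * u 0 x * u 2 x))) * h x
  · simp only [hu.apply_two_pi, hξ.apply_two_pi, hw.apply_two_pi, hη.apply_two_pi]

end Identities

/-! ### Energy estimates at a fixed time -/

theorem cubic_term_le {M N₀ N₁ X s₀ : ℝ} (hN₁ : 0 ≤ N₁) (hX : 0 ≤ X)
    (hs₀ : 0 ≤ s₀) (hM : N₀ ≤ M) (hM1 : 1 ≤ M) (h1 : N₁ ^ 2 ≤ N₀ * X) (hs : s₀ ^ 2 = 2 * N₀ * N₁) :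
    5 / 3 * (s₀ * N₁ ^ 2) ≤ X ^ 2 / 2 + ((50 / 9 * M ^ 3) ^ 2 / 2 + M ^ 2 / 4) := by
  have a1 : N₁ ^ 2 ≤ M * X := h1.trans (by gcongr)
  have a2 : s₀ ^ 2 ≤ 2 * M * N₁ := hs.trans_le (by gcongr)
  have a3 : s₀ * N₁ ^ 2 ≤ s₀ * (M * X) := by gcongr
  have a4 : M ^ 2 * s₀ ^ 2 ≤ M ^ 2 * (2 * M * N₁) := by gcongr
  nlinarith [sq_nonneg (X / 2 - 5 / 3 * M * s₀), sq_nonneg (N₁ - 50 / 9 * M ^ 3),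
    sq_nonneg (X / 2 - M / 2)]

theorem energy_rhs_le {γ ε B M ν N₀ N₁ X Y s₀ s₁ H : ℝ} (hγ : 0 ≤ γ) (hε : 0 < ε) (hε1 : ε ≤ 1)
    (hB : 0 ≤ B) (hN₀ : 0 ≤ N₀) (hN₁ : 0 ≤ N₁) (hX : 0 ≤ X) (hY : 0 ≤ Y)
    (hH0 : 0 ≤ H) (hH : H ≤ ν) (hM : N₀ ≤ M) (hM1 : 1 ≤ M)
    (h1 : N₁ ^ 2 ≤ N₀ * X) (h2 : X ^ 2 ≤ N₀ * Y)
    (hS₀ : s₀ ^ 2 = 2 * N₀ * N₁) (hS₁ : s₁ ^ 2 = 2 * N₁ * X) :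
    (8 / 3 * B + 5 / 3 * B * s₀ ^ 2) * N₀ ^ 2
      + (14 / 3 * B + 5 * γ * s₀ + 5 / 3 * (s₀ * s₁) + 25 / 18 * ε * s₁ ^ 2) * N₁ ^ 2
      + (1 + 37 / 3 * B + 50 / 9 * ε * s₀ ^ 2) * X ^ 2 + (-ε) * Y ^ 2 + H ^ 2
    ≤ (8 / 3 * B * M ^ 2 + 10 / 3 * B * M ^ 4 + 14 / 3 * B * M + 10 * γ * M ^ 2 + 10 / 3 * M ^ 2
        + (1 + 37 / 3 * B) + 125 / 9 * M + (125 / 9 * M ^ 2) ^ 2 * M ^ 2 / 2 + ν ^ 2) * (1 + X ^ 2)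
      - ε / 2 * Y ^ 2 := by
  set Z := 1 + X ^ 2 with hZ
  have hZ1 : 1 ≤ Z := by nlinarith
  have hXZ : X ≤ Z := by nlinarith
  have hX2Z : X ^ 2 ≤ Z := by linarith
  have hM0 : 0 ≤ M := by linarith
  have a1 : N₁ ^ 2 ≤ M * X := h1.trans (by gcongr)
  have a2 : s₀ ^ 2 ≤ 2 * M * N₁ := hS₀.trans_le (by gcongr)
  have a3 : X ^ 2 ≤ M * Y := h2.trans (by gcongr)
  have hMZ : 1 ≤ M * Z := by nlinarith
  have hMX : M * X ≤ M * Z := by gcongr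
  have hN : 2 * N₁ ≤ 1 + M * X := by nlinarith [sq_nonneg (N₁ - 1)]
  have hN' : N₁ ≤ 1 + M * X := by nlinarith
  have a4 : s₀ ^ 2 ≤ 2 * M ^ 2 * Z := by
    calc s₀ ^ 2 ≤ M * (2 * N₁) := by linarith
      _ ≤ M * (2 * (M * Z)) := by gcongr; linarith
      _ = _ := by ring
  have b1 : N₀ ^ 2 ≤ M ^ 2 * Z := by
    calc N₀ ^ 2 ≤ M ^ 2 * 1 := by rw [mul_one]; gcongr
      _ ≤ _ := by gcongr
  have b2 : s₀ ^ 2 * N₀ ^ 2 ≤ 2 * M ^ 4 * Z := by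
    calc s₀ ^ 2 * N₀ ^ 2 ≤ (2 * M ^ 2 * Z) * M ^ 2 := by gcongr
      _ = _ := by ring
  have b3 : N₁ ^ 2 ≤ M * Z := a1.trans hMX
  have hN4 : N₁ ^ 2 * N₁ ^ 2 ≤ M ^ 2 * Z := by
    calc N₁ ^ 2 * N₁ ^ 2 ≤ (M * X) * (M * X) := by gcongr
      _ = M ^ 2 * X ^ 2 := by ring
      _ ≤ _ := by gcongr
  have b4 : s₀ * N₁ ^ 2 ≤ 2 * M ^ 2 * Z := by
    have : 0 ≤ M ^ 2 * Z := by positivity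
    nlinarith [sq_nonneg (s₀ - N₁ ^ 2)]
  have hss : s₀ * s₁ ≤ 2 * M * X := by
    refine abs_le_of_sq_le_sq' ?_ (by positivity) |>.2
    calc (s₀ * s₁) ^ 2 = s₀ ^ 2 * s₁ ^ 2 := by ring
      _ = 4 * N₀ * N₁ ^ 2 * X := by rw [hS₀, hS₁]; ring
      _ ≤ 4 * M * (M * X) * X := by gcongr
      _ = _ := by ring
  have b5 : s₀ * s₁ * N₁ ^ 2 ≤ 2 * M ^ 2 * Z := by
    calc s₀ * s₁ * N₁ ^ 2 ≤ 2 * M * X * (M * X) := by gcongr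
      _ = 2 * M ^ 2 * X ^ 2 := by ring
      _ ≤ _ := by gcongr
  have b6 : s₁ ^ 2 * N₁ ^ 2 ≤ 2 * M * X ^ 2 + 2 * M ^ 2 * (X * X ^ 2) := by
    calc s₁ ^ 2 * N₁ ^ 2 = 2 * N₁ * X * N₁ ^ 2 := by rw [hS₁]
      _ ≤ 2 * (1 + M * X) * X * (M * X) := by gcongr
      _ = _ := by ring
  have b7 : s₀ ^ 2 * X ^ 2 ≤ 2 * M * X ^ 2 + 2 * M ^ 2 * (X * X ^ 2) := by
    calc s₀ ^ 2 * X ^ 2 ≤ 2 * M * (1 + M * X) * X ^ 2 := by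
          gcongr
          exact a2.trans (by gcongr)
      _ = _ := by ring
  have b8 : 125 / 9 * M ^ 2 * (X * X ^ 2) ≤ Y ^ 2 / 2 + (125 / 9 * M ^ 2) ^ 2 * M ^ 2 / 2 * X ^ 2 := by
    have : 125 / 9 * M ^ 2 * (X * X ^ 2) ≤ 125 / 9 * M ^ 2 * (X * (M * Y)) := by gcongr
    nlinarith [sq_nonneg (Y - 125 / 9 * M ^ 2 * M * X)]
  have b9 : ε * (25 / 18 * (s₁ ^ 2 * N₁ ^ 2) + 50 / 9 * (s₀ ^ 2 * X ^ 2))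
      ≤ ε / 2 * Y ^ 2 + (125 / 9 * M * Z + (125 / 9 * M ^ 2) ^ 2 * M ^ 2 / 2 * Z) := by
    have c1 : 25 / 18 * (s₁ ^ 2 * N₁ ^ 2) + 50 / 9 * (s₀ ^ 2 * X ^ 2)
        ≤ Y ^ 2 / 2 + (125 / 9 * M * X ^ 2 + (125 / 9 * M ^ 2) ^ 2 * M ^ 2 / 2 * X ^ 2) := by
      linarith
    have c2 : 125 / 9 * M * X ^ 2 + (125 / 9 * M ^ 2) ^ 2 * M ^ 2 / 2 * X ^ 2
        ≤ 125 / 9 * M * Z + (125 / 9 * M ^ 2) ^ 2 * M ^ 2 / 2 * Z := by gcongr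
    have c3 : 0 ≤ 125 / 9 * M * Z + (125 / 9 * M ^ 2) ^ 2 * M ^ 2 / 2 * Z := by positivity
    calc _ ≤ ε * (Y ^ 2 / 2 + (125 / 9 * M * Z + (125 / 9 * M ^ 2) ^ 2 * M ^ 2 / 2 * Z)) := 
          mul_le_mul_of_nonneg_left (c1.trans (by linarith)) hε.le
      _ = ε / 2 * Y ^ 2 + ε * (125 / 9 * M * Z + (125 / 9 * M ^ 2) ^ 2 * M ^ 2 / 2 * Z) := by ring
      _ ≤ _ := by
          gcongr
          exact mul_le_of_le_one_left c3 hε1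
  have b10 : H ^ 2 ≤ ν ^ 2 * Z := by
    calc H ^ 2 ≤ ν ^ 2 * 1 := by rw [mul_one]; gcongr
      _ ≤ _ := by gcongr
  have e1 := mul_le_mul_of_nonneg_left b1 hB
  have e2 := mul_le_mul_of_nonneg_left b2 hB
  have e3 := mul_le_mul_of_nonneg_left b3 hB
  have e4 := mul_le_mul_of_nonneg_left b4 hγ
  have e5 := mul_le_mul_of_nonneg_left hX2Z hB
  linarith

theorem energy_integrand_le {γ ε B s₀ s₁ u₀ u₁ u₂ u₄ z₁ z₂ z₃ e₀ e₂ : ℝ} (hγ : 0 ≤ γ) (hε : 0 ≤ ε)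
    (hu₀ : |u₀| ≤ s₀) (hu₁ : |u₁| ≤ s₁) (hz₁ : |z₁| ≤ B) (hz₂ : |z₂| ≤ B) (hz₃ : |z₃| ≤ B)
    (he₀ : |e₀| ≤ B) :
    2 * e₂ * u₂ + 5 / 3 * e₀ * (u₁ ^ 2 + 2 * u₀ * u₂)
        - 2 * γ * u₂ ^ 2 + 5 * γ * u₀ * u₁ ^ 2 + 5 / 3 * u₀ * u₁ ^ 3
        - 2 * z₃ * u₀ * u₂ - 6 * z₂ * u₁ * u₂ - 5 * z₁ * u₂ ^ 2
        - 10 / 3 * z₁ * u₀ ^ 2 * u₂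
        - 2 * ε * u₄ ^ 2 - 5 / 3 * ε * u₄ * (u₁ ^ 2 + 2 * u₀ * u₂)
      ≤ (8 / 3 * B + 5 / 3 * B * s₀ ^ 2) * u₀ ^ 2
        + (14 / 3 * B + 5 * γ * s₀ + 5 / 3 * (s₀ * s₁) + 25 / 18 * ε * s₁ ^ 2) * u₁ ^ 2
        + (1 + 37 / 3 * B + 50 / 9 * ε * s₀ ^ 2) * u₂ ^ 2 + (-ε) * u₄ ^ 2 + e₂ ^ 2 := by
  have hs₀ : 0 ≤ s₀ := (abs_nonneg _).trans hu₀
  have hs₁ : 0 ≤ s₁ := (abs_nonneg _).trans hu₁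
  have hB : 0 ≤ B := (abs_nonneg _).trans hz₁
  have prod : ∀ {z p q : ℝ}, |z| ≤ B → 2 * (z * (p * q)) ≤ B * (p ^ 2 + q ^ 2) := by
    intro z p q hz
    calc 2 * (z * (p * q)) ≤ |2 * (z * (p * q))| := le_abs_self _
      _ = |z| * (2 * |p| * |q|) := by simp only [abs_mul, abs_two]; ring
      _ ≤ B * (|p| ^ 2 + |q| ^ 2) := by
          gcongr
          exact two_mul_le_add_sq _ _
      _ = _ := by rw [sq_abs, sq_abs]
  have neg : ∀ {z : ℝ}, |z| ≤ B → |-z| ≤ B := fun h => by rwa [abs_neg]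
  have sq : ∀ {z p b : ℝ}, |z| ≤ b → z * p ^ 2 ≤ b * p ^ 2 := fun h =>
    mul_le_mul_of_nonneg_right ((le_abs_self _).trans h) (sq_nonneg _)
  have q0 : u₀ ^ 2 ≤ s₀ ^ 2 := sq_le_sq' (abs_le.1 hu₀).1 (abs_le.1 hu₀).2
  have q1 : u₁ ^ 2 ≤ s₁ ^ 2 := sq_le_sq' (abs_le.1 hu₁).1 (abs_le.1 hu₁).2
  have t1 := two_mul_le_add_sq e₂ u₂
  have t2 := sq (p := u₁) he₀
  have t3 := prod (p := u₀) (q := u₂) he₀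
  have t4 : γ * (u₀ * u₁ ^ 2) ≤ γ * (s₀ * u₁ ^ 2) := mul_le_mul_of_nonneg_left (sq hu₀) hγ
  have t5 : u₀ * u₁ * u₁ ^ 2 ≤ s₀ * s₁ * u₁ ^ 2 := sq (by rw [abs_mul]; gcongr)
  have t6 := prod (p := u₀) (q := u₂) (neg hz₃)
  have t7 := prod (p := u₁) (q := u₂) (neg hz₂)
  have t8 := sq (p := u₂) (neg hz₁)
  have t9 := prod (p := u₀ ^ 2) (q := u₂) (neg hz₁)
  have t9' : B * (u₀ ^ 2 * u₀ ^ 2) ≤ B * (s₀ ^ 2 * u₀ ^ 2) := by gcongr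
  have t10 : ε * (-(5 / 3 * u₄ * u₁ ^ 2)) ≤ ε * (u₄ ^ 2 / 2 + 25 / 18 * (s₁ ^ 2 * u₁ ^ 2)) := by
    have : u₁ ^ 2 * u₁ ^ 2 ≤ s₁ ^ 2 * u₁ ^ 2 := by gcongr
    gcongr
    nlinarith [sq_nonneg (u₄ + 5 / 3 * u₁ ^ 2)]
  have t11 : ε * (-(10 / 3 * u₄ * (u₀ * u₂))) ≤ ε * (u₄ ^ 2 / 2 + 50 / 9 * (s₀ ^ 2 * u₂ ^ 2)) := by
    have : u₀ ^ 2 * u₂ ^ 2 ≤ s₀ ^ 2 * u₂ ^ 2 := by gcongr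
    gcongr
    nlinarith [sq_nonneg (u₄ + 10 / 3 * (u₀ * u₂))]
  have t12 : 0 ≤ γ * u₂ ^ 2 := by positivity
  linarith

theorem integral_sq_combination {f₀ f₁ f₂ f₃ f₄ : ℝ → ℝ} (h₀ : Continuous f₀) (h₁ : Continuous f₁)
    (h₂ : Continuous f₂) (h₃ : Continuous f₃) (h₄ : Continuous f₄) (c₀ c₁ c₂ c₃ : ℝ) :
    ∫ x in (0 : ℝ)..(2 * Real.pi), (c₀ * f₀ x ^ 2 + c₁ * f₁ x ^ 2 + c₂ * f₂ x ^ 2 + c₃ * f₃ x ^ 2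
        + f₄ x ^ 2)
      = c₀ * L2norm f₀ ^ 2 + c₁ * L2norm f₁ ^ 2 + c₂ * L2norm f₂ ^ 2 + c₃ * L2norm f₃ ^ 2
        + L2norm f₄ ^ 2 := by
  simp only [L2norm_sq]
  rw [intervalIntegral.integral_add (Continuous.intervalIntegrable (by fun_prop) _ _)
      (Continuous.intervalIntegrable (by fun_prop) _ _),
    intervalIntegral.integral_add (Continuous.intervalIntegrable (by fun_prop) _ _)
      (Continuous.intervalIntegrable (by fun_prop) _ _),
    intervalIntegral.integral_add (Continuous.intervalIntegrable (by fun_prop) _ _)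
      (Continuous.intervalIntegrable (by fun_prop) _ _),
    intervalIntegral.integral_add (Continuous.intervalIntegrable (by fun_prop) _ _)
      (Continuous.intervalIntegrable (by fun_prop) _ _)]
  simp only [intervalIntegral.integral_const_mul]

theorem PeriodicJet.L2norm_succ_sq_le {u : ℕ → ℝ → ℝ} (hu : PeriodicJet u) (k : ℕ) :
    L2norm (u (k + 1)) ^ 2 ≤ L2norm (u k) * L2norm (u (k + 2)) := by
  have c := hu.continuous
  rw [L2norm_sq, integral_eq_of_hasDerivAt_sub (g := fun x => u k x * -u (k + 2) x)
    (q := fun x => u k x * u (k + 1) x) (by fun_prop) (by fun_prop)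
    (fun x => ((hu.hasDerivAt k x).mul (hu.hasDerivAt (k + 1) x)).congr_deriv (by ring))
    (by simp only [hu.apply_two_pi])]
  refine (integral_mul_le_L2norm (c k) (c (k + 2)).neg).trans_eq ?_
  simp [L2norm]

theorem PeriodicJet.L2norm_two_sq_le {u : ℕ → ℝ → ℝ} (hu : PeriodicJet u) :
    L2norm (u 2) ^ 2 ≤ L2norm (u 0) * L2norm (u 4) := by
  have c := hu.continuous
  rw [L2norm_sq, integral_eq_of_hasDerivAt_sub (g := fun x => u 0 x * u 4 x)
    (q := fun x => u 1 x * u 2 x - u 0 x * u 3 x) (by fun_prop) (by fun_prop)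
    (fun x => (((hu.hasDerivAt 1 x).mul (hu.hasDerivAt 2 x)).sub
      ((hu.hasDerivAt 0 x).mul (hu.hasDerivAt 3 x))).congr_deriv (by ring))
    (by simp only [hu.apply_two_pi])]
  exact integral_mul_le_L2norm (c 0) (c 4)

section Estimates

variable {γ ε B M ν : ℝ} {u w ξ η : ℕ → ℝ → ℝ}

theorem integral_L2_energy_le (hγ : 0 ≤ γ) (hε : 0 ≤ ε)
    (hu : PeriodicJet u) (hw : PeriodicJet w) (hξ : PeriodicJet ξ) (hη : PeriodicJet η)
    (h : ∀ x, w 0 x + γ * u 0 x + u 3 x + (ξ 1 x * u 0 x + ξ 0 x * u 1 x) + u 0 x * u 1 x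
      + ε * u 4 x = η 0 x) (hξB : ∀ x, |ξ 1 x| ≤ B) :
    ∫ x in (0 : ℝ)..(2 * Real.pi), 2 * u 0 x * w 0 x
      ≤ (1 + B) * L2norm (u 0) ^ 2 + L2norm (η 0) ^ 2 := by
  have cu := hu.continuous
  have cξ := hξ.continuous
  have cη := hη.continuous
  have hcomb := integral_sq_combination (cu 0) (cu 0) (cu 0) (cu 0) (cη 0) (1 + B) 0 0 0
  simp only [zero_mul, add_zero] at hcomb
  rw [integral_L2_energy hu hw hξ hη h, ← hcomb]
  refine intervalIntegral.integral_mono Real.two_pi_pos.le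
    (Continuous.intervalIntegrable (by fun_prop) _ _)
    (Continuous.intervalIntegrable (by fun_prop) _ _) fun x => ?_
  have h1 := (abs_le.1 (hξB x)).1
  have h2 : 0 ≤ γ * u 0 x ^ 2 := by positivity
  have h3 : 0 ≤ ε * u 2 x ^ 2 := by positivity
  have h4 := mul_le_mul_of_nonneg_right h1 (sq_nonneg (u 0 x))
  have h5 := two_mul_le_add_sq (u 0 x) (η 0 x)
  dsimp only
  linarith

theorem abs_integral_mul_sq_le {s₀ : ℝ} (hu : PeriodicJet u) (hs : ∀ x, |u 0 x| ≤ s₀) :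
    |∫ x in (0 : ℝ)..(2 * Real.pi), u 0 x * u 1 x ^ 2| ≤ s₀ * L2norm (u 1) ^ 2 := by
  have cu := hu.continuous
  rw [L2norm_sq, ← intervalIntegral.integral_const_mul]
  refine (intervalIntegral.abs_integral_le_integral_abs Real.two_pi_pos.le).trans ?_
  refine intervalIntegral.integral_mono Real.two_pi_pos.le
    (Continuous.intervalIntegrable (by fun_prop) _ _)
    (Continuous.intervalIntegrable (by fun_prop) _ _) fun x => ?_
  dsimp only
  rw [abs_mul, abs_of_nonneg (sq_nonneg (u 1 x))]
  gcongr
  exact hs x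

theorem integral_H2_energy_le (hγ : 0 ≤ γ) (hε : 0 < ε) (hε1 : ε ≤ 1)
    (hu : PeriodicJet u) (hw : PeriodicJet w) (hξ : PeriodicJet ξ) (hη : PeriodicJet η)
    (h : ∀ x, w 0 x + γ * u 0 x + u 3 x + (ξ 1 x * u 0 x + ξ 0 x * u 1 x) + u 0 x * u 1 x
      + ε * u 4 x = η 0 x)
    (hu0 : ∀ x, u 0 x ^ 2 ≤ 2 * L2norm (u 0) * L2norm (u 1))
    (hu1 : ∀ x, u 1 x ^ 2 ≤ 2 * L2norm (u 1) * L2norm (u 2))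
    (hM : L2norm (u 0) ≤ M) (hM1 : 1 ≤ M)
    (hξ1 : ∀ x, |ξ 1 x| ≤ B) (hξ2 : ∀ x, |ξ 2 x| ≤ B) (hξ3 : ∀ x, |ξ 3 x| ≤ B)
    (hη0 : ∀ x, |η 0 x| ≤ B) (hη2 : L2norm (η 2) ≤ ν) :
    ∫ x in (0 : ℝ)..(2 * Real.pi),
        (2 * u 2 x * w 2 x - 5 / 3 * (w 0 x * u 1 x ^ 2 + u 0 x * (2 * u 1 x * w 1 x)))
      ≤ (8 / 3 * B * M ^ 2 + 10 / 3 * B * M ^ 4 + 14 / 3 * B * M + 10 * γ * M ^ 2 + 10 / 3 * M ^ 2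
        + (1 + 37 / 3 * B) + 125 / 9 * M + (125 / 9 * M ^ 2) ^ 2 * M ^ 2 / 2 + ν ^ 2)
          * (1 + L2norm (u 2) ^ 2)
      - ε / 2 * L2norm (u 4) ^ 2 := by
  have cu := hu.continuous
  have cξ := hξ.continuous
  have cη := hη.continuous
  have n := fun k => L2norm_nonneg (u k)
  have p0 : 0 ≤ 2 * L2norm (u 0) * L2norm (u 1) := mul_nonneg (by linarith [n 0]) (n 1)
  have p1 : 0 ≤ 2 * L2norm (u 1) * L2norm (u 2) := mul_nonneg (by linarith [n 1]) (n 2)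
  refine le_trans ?_ (energy_rhs_le hγ hε hε1 ((abs_nonneg _).trans (hξ1 0)) (n 0) (n 1) (n 2)
    (n 4) (L2norm_nonneg (η 2)) hη2 hM hM1
    (hu.L2norm_succ_sq_le 0) hu.L2norm_two_sq_le (Real.sq_sqrt p0) (Real.sq_sqrt p1))
  rw [integral_H2_energy hu hw hξ hη h,
    ← integral_sq_combination (cu 0) (cu 1) (cu 2) (cu 4) (cη 2)]
  refine intervalIntegral.integral_mono Real.two_pi_pos.le
    (Continuous.intervalIntegrable (by fun_prop) _ _)
    (Continuous.intervalIntegrable (by fun_prop) _ _) fun x => ?_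
  exact energy_integrand_le hγ hε.le (Real.abs_le_sqrt (hu0 x)) (Real.abs_le_sqrt (hu1 x))
    (hξ1 x) (hξ2 x) (hξ3 x) (hη0 x)

end Estimates

/-! ### A priori bounds for solutions -/

section Solutions

variable {γ ε T ρ ν B M t : ℝ} {ξ η v : ℝ → ℝ → ℝ}

theorem IsRegSol.equation (hv : IsRegSol γ ε T ξ η v) (hξ : RegData T 5 ρ ξ) (h0 : 0 ≤ t)
    (hT : t ≤ T) (x : ℝ) :
    iteratedDeriv 0 (fun y => deriv (fun s => v s y) t) x + γ * iteratedDeriv 0 (v t) x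
      + iteratedDeriv 3 (v t) x + (iteratedDeriv 1 (ξ t) x * iteratedDeriv 0 (v t) x
      + iteratedDeriv 0 (ξ t) x * iteratedDeriv 1 (v t) x)
      + iteratedDeriv 0 (v t) x * iteratedDeriv 1 (v t) x + ε * iteratedDeriv 4 (v t) x
      = iteratedDeriv 0 (η t) x := by
  have h := hv.2.2 t x h0 hT
  rw [(((hξ.2.1 t h0 hT).hasDerivAt x).fun_mul ((hv.2.1 t h0 hT).hasDerivAt x)).deriv] at h
  simpa only [iteratedDeriv_zero, iteratedDeriv_one] using h

theorem IsRegSol.periodicJet (hv : IsRegSol γ ε T ξ η v) (h0 : 0 ≤ t) (hT : t ≤ T) :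
    PeriodicJet fun k => iteratedDeriv k (v t) :=
  periodicJet_iteratedDeriv (hv.2.1 t h0 hT).1 (hv.2.1 t h0 hT).2.1

theorem RegData.periodicJet {m : ℕ} (hξ : RegData T m ρ ξ) (h0 : 0 ≤ t) (hT : t ≤ T) :
    PeriodicJet fun k => iteratedDeriv k (ξ t) :=
  periodicJet_iteratedDeriv (hξ.2.1 t h0 hT).1 (hξ.2.1 t h0 hT).2.1

theorem IsRegSol.periodicJet_deriv (hv : IsRegSol γ ε T ξ η v) (hξ : RegData T 5 ρ ξ)
    (hη : RegData T 2 ν η) (h0 : 0 ≤ t) (hT : t ≤ T) :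
    PeriodicJet fun k => iteratedDeriv k fun y => deriv (fun s => v s y) t := by
  refine periodicJet_iteratedDeriv ((contDiff_deriv_fst hv.1).comp
    (contDiff_const.prodMk contDiff_id)) fun x => ?_
  have e1 := hv.equation hξ h0 hT x
  have e2 := hv.equation hξ h0 hT (x + 2 * Real.pi)
  have pv := fun k => ((hv.2.1 t h0 hT).iteratedDeriv k).2.1 x
  have pξ := fun k => ((hξ.2.1 t h0 hT).iteratedDeriv k).2.1 x
  have pη := fun k => ((hη.2.1 t h0 hT).iteratedDeriv k).2.1 x
  rw [pη, pv, pv, pv, pv, pξ, pξ] at e2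
  rw [iteratedDeriv_zero] at e1 e2
  linarith

theorem RegData.abs_iteratedDeriv_le {j m : ℕ} (hξ : RegData T m ρ ξ) (hj : j < m) (h0 : 0 ≤ t)
    (hT : t ≤ T) (x : ℝ) : |iteratedDeriv j (ξ t) x| ≤ (4 * Real.pi) ^ m * ρ :=
  ((hξ.2.1 t h0 hT).abs_iteratedDeriv_le hj x).trans
    (mul_le_mul_of_nonneg_left (hξ.2.2 t h0 hT) (by positivity))

theorem RegData.L2norm_le {m : ℕ} (hξ : RegData T m ρ ξ) (h0 : 0 ≤ t) (hT : t ≤ T) :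
    L2norm (ξ t) ≤ (4 * Real.pi) ^ m * ρ :=
  ((hξ.2.1 t h0 hT).L2norm_le_Hnorm m).trans
    (mul_le_mul_of_nonneg_left (hξ.2.2 t h0 hT) (by positivity))

theorem hasDerivAt_integral_sq
    (hv : ContDiff ℝ (⊤ : ℕ∞) fun p : ℝ × ℝ => v p.1 p.2) (t : ℝ) :
    HasDerivAt (fun s => ∫ x in (0 : ℝ)..(2 * Real.pi), v s x ^ 2)
      (∫ x in (0 : ℝ)..(2 * Real.pi), 2 * iteratedDeriv 0 (v t) x
        * iteratedDeriv 0 (fun y => deriv (fun s => v s y) t) x) t := by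
  refine (hasDerivAt_intervalIntegral_of_contDiff (f := fun s x => v s x ^ 2) (hv.pow 2)
    0 (2 * Real.pi) t).congr_deriv ?_
  congr 1
  ext x
  rw [((hasDerivAt_fst_deriv hv t x).fun_pow 2).deriv]
  simp

theorem hasDerivAt_integral_H2_energy
    (hv : ContDiff ℝ (⊤ : ℕ∞) fun p : ℝ × ℝ => v p.1 p.2) (t : ℝ) :
    HasDerivAt (fun s => ∫ x in (0 : ℝ)..(2 * Real.pi), (iteratedDeriv 2 (v s) x ^ 2
        - 5 / 3 * (iteratedDeriv 0 (v s) x * iteratedDeriv 1 (v s) x ^ 2)))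
      (∫ x in (0 : ℝ)..(2 * Real.pi),
        (2 * iteratedDeriv 2 (v t) x * iteratedDeriv 2 (fun y => deriv (fun s => v s y) t) x
          - 5 / 3 * (iteratedDeriv 0 (fun y => deriv (fun s => v s y) t) x
              * iteratedDeriv 1 (v t) x ^ 2
            + iteratedDeriv 0 (v t) x * (2 * iteratedDeriv 1 (v t) x
              * iteratedDeriv 1 (fun y => deriv (fun s => v s y) t) x)))) t := by
  have c := fun k => contDiff_iteratedDeriv_snd hv k
  refine (hasDerivAt_intervalIntegral_of_contDiff (f := fun s x => iteratedDeriv 2 (v s) x ^ 2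
    - 5 / 3 * (iteratedDeriv 0 (v s) x * iteratedDeriv 1 (v s) x ^ 2))
    (((c 2).pow 2).sub (contDiff_const.mul ((c 0).mul ((c 1).pow 2))))
    0 (2 * Real.pi) t).congr_deriv ?_
  congr 1
  ext x
  have d := fun k => hasDerivAt_fst_iteratedDeriv hv k t x
  rw [(((d 2).fun_pow 2).fun_sub (((d 0).fun_mul ((d 1).fun_pow 2)).const_mul (5 / 3))).deriv]
  norm_num

theorem continuous_Hnorm_sq (hv : ContDiff ℝ (⊤ : ℕ∞) fun p : ℝ × ℝ => v p.1 p.2) (k : ℕ) :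
    Continuous fun s => Hnorm k (v s) ^ 2 := by
  simp only [Hnorm, L2norm_sq]
  exact continuous_iff_continuousAt.2 fun t => (hasDerivAt_intervalIntegral_of_contDiff
    (f := fun s x => iteratedDeriv k (v s) x ^ 2) ((contDiff_iteratedDeriv_snd hv k).pow 2)
    0 (2 * Real.pi) t).continuousAt

theorem IsRegSol.L2norm_sq_le {μ : ℝ} (hγ : 0 ≤ γ) (hε : 0 ≤ ε) (hB : 0 ≤ B)
    (hv : IsRegSol γ ε T ξ η v) (hξ : RegData T 5 ρ ξ) (hη : RegData T 2 ν η)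
    (hξB : (4 * Real.pi) ^ 5 * ρ ≤ B) (hηB : (4 * Real.pi) ^ 2 * ν ≤ B)
    (hμ : L2norm (v 0) ≤ μ) (h0 : 0 ≤ t) (hT : t ≤ T) :
    L2norm (v t) ^ 2 + 1 ≤ Real.exp ((1 + B + B ^ 2) * T) * (μ ^ 2 + 1) := by
  have key := add_integral_le_exp_mul (g := fun _ => 0) (A := 1 + B + B ^ 2) (T := T)
    (f := fun s => (∫ x in (0 : ℝ)..(2 * Real.pi), v s x ^ 2) + 1) (by positivity)
    (fun s _ _ => (hasDerivAt_integral_sq hv.1 s).add_const 1) continuous_const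
    (fun _ => le_rfl) (fun s hs0 hsT => ?_) h0 hT
  · simp only [intervalIntegral.integral_zero, add_zero, ← L2norm_sq] at key
    refine key.trans ?_
    have := L2norm_nonneg (v 0)
    gcongr
  · refine (integral_L2_energy_le hγ hε (hv.periodicJet hs0 hsT)
      (hv.periodicJet_deriv hξ hη hs0 hsT) (hξ.periodicJet hs0 hsT) (hη.periodicJet hs0 hsT)
      (hv.equation hξ hs0 hsT)
      (fun x => (hξ.abs_iteratedDeriv_le (by norm_num) hs0 hsT x).trans hξB)).trans ?_
    simp only [iteratedDeriv_zero, ← L2norm_sq]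
    have h1 : L2norm (η s) ^ 2 ≤ B ^ 2 :=
      pow_le_pow_left₀ (L2norm_nonneg _) ((hη.L2norm_le hs0 hsT).trans hηB) 2
    nlinarith [sq_nonneg (L2norm (v s)), mul_nonneg (sq_nonneg B) (sq_nonneg (L2norm (v s)))]

theorem IsRegSol.abs_H2_energy_sub_le (hv : IsRegSol γ ε T ξ η v) (h0 : 0 ≤ t) (hT : t ≤ T)
    (hM : L2norm (v t) ≤ M) (hM1 : 1 ≤ M) :
    |(∫ x in (0 : ℝ)..(2 * Real.pi), (iteratedDeriv 2 (v t) x ^ 2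
        - 5 / 3 * (iteratedDeriv 0 (v t) x * iteratedDeriv 1 (v t) x ^ 2)))
      - Hnorm 2 (v t) ^ 2| ≤ Hnorm 2 (v t) ^ 2 / 2 + ((50 / 9 * M ^ 3) ^ 2 / 2 + M ^ 2 / 4) := by
  have hu := hv.periodicJet h0 hT
  have cu : ∀ k, Continuous (iteratedDeriv k (v t)) := hu.continuous
  have p0 : 0 ≤ 2 * L2norm (v t) * L2norm (iteratedDeriv 1 (v t)) :=
    mul_nonneg (by linarith [L2norm_nonneg (v t)]) (L2norm_nonneg _)
  have h1 := abs_integral_mul_sq_le hu (s₀ := √(2 * L2norm (v t) * L2norm (iteratedDeriv 1 (v t))))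
    fun x => Real.abs_le_sqrt (by
      simpa only [iteratedDeriv_zero, iteratedDeriv_one] using (hv.2.1 t h0 hT).sq_le x)
  have h2 := cubic_term_le (L2norm_nonneg (iteratedDeriv 1 (v t)))
    (L2norm_nonneg (iteratedDeriv 2 (v t))) (Real.sqrt_nonneg _) hM hM1
    (by simpa only [iteratedDeriv_zero] using hu.L2norm_succ_sq_le 0) (Real.sq_sqrt p0)
  rw [intervalIntegral.integral_sub (Continuous.intervalIntegrable (by fun_prop) _ _)
    (Continuous.intervalIntegrable (by fun_prop) _ _),
    intervalIntegral.integral_const_mul, Hnorm, ← L2norm_sq, sub_sub_cancel_left, abs_neg, abs_mul,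
    abs_of_nonneg (by norm_num : (0 : ℝ) ≤ 5 / 3)]
  exact (mul_le_mul_of_nonneg_left h1 (by norm_num)).trans h2

/-- The `H²` energy estimate for solutions bounded in `L²`, uniform in `ε`. -/
theorem exists_H2_energy_bound (T μ : ℝ) (hγ : 0 ≤ γ) (hB : 0 ≤ B) (hM1 : 1 ≤ M) :
    ∃ R : ℝ, 0 ≤ R ∧ ∀ ε : ℝ, 0 < ε → ε ≤ 1 → ∀ ξ η v : ℝ → ℝ → ℝ,
      RegData T 5 ρ ξ → RegData T 2 ν η → IsRegSol γ ε T ξ η v →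
      (4 * Real.pi) ^ 5 * ρ ≤ B → (4 * Real.pi) ^ 2 * ν ≤ B →
      (∀ t, 0 ≤ t → t ≤ T → L2norm (v t) ≤ M) → Hnorm 2 (v 0) ≤ μ →
      ∀ t, 0 ≤ t → t ≤ T →
        Hnorm 2 (v t) ^ 2 + ε * ∫ s in (0 : ℝ)..t, Hnorm 4 (v s) ^ 2 ≤ R := by
  set L := (50 / 9 * M ^ 3) ^ 2 / 2 + M ^ 2 / 4 with hL
  set K := 8 / 3 * B * M ^ 2 + 10 / 3 * B * M ^ 4 + 14 / 3 * B * M + 10 * γ * M ^ 2 + 10 / 3 * M ^ 2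
        + (1 + 37 / 3 * B) + 125 / 9 * M + (125 / 9 * M ^ 2) ^ 2 * M ^ 2 / 2 + ν ^ 2 with hK
  have hM0 : 0 ≤ M := by linarith
  have hL0 : 0 ≤ L := by positivity
  have hK0 : 0 ≤ K := by positivity
  refine ⟨2 * (Real.exp (2 * K * T) * (3 / 2 * μ ^ 2 + 2 * L + 1)), by positivity, ?_⟩
  intro ε hε hε1 ξ η v hξ hη hv hξB hηB hM hμ t h0 hT
  set F : ℝ → ℝ := fun s => ∫ x in (0 : ℝ)..(2 * Real.pi), (iteratedDeriv 2 (v s) x ^ 2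
        - 5 / 3 * (iteratedDeriv 0 (v s) x * iteratedDeriv 1 (v s) x ^ 2)) with hF
  have hFL : ∀ s, 0 ≤ s → s ≤ T → |F s - Hnorm 2 (v s) ^ 2| ≤ Hnorm 2 (v s) ^ 2 / 2 + L :=
    fun s hs0 hsT => hv.abs_H2_energy_sub_le hs0 hsT (hM s hs0 hsT) hM1
  have key := add_integral_le_exp_mul (g := fun s => ε / 2 * Hnorm 4 (v s) ^ 2) (A := 2 * K) (T := T)
    (f := fun s => F s + (L + 1)) (by positivity)
    (fun s _ _ => (hasDerivAt_integral_H2_energy hv.1 s).add_const (L + 1))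
    (continuous_const.mul (continuous_Hnorm_sq hv.1 4))
    (fun s => by positivity) (fun s hs0 hsT => ?_) h0 hT
  · rw [intervalIntegral.integral_const_mul] at key
    have e1 := (abs_le.1 (hFL t h0 hT)).1
    have e2 := (abs_le.1 (hFL 0 le_rfl (h0.trans hT))).2
    have e3 : Hnorm 2 (v 0) ^ 2 ≤ μ ^ 2 := pow_le_pow_left₀ (L2norm_nonneg _) hμ 2
    have e4 : Real.exp (2 * K * t) * (F 0 + (L + 1))
        ≤ Real.exp (2 * K * T) * (3 / 2 * μ ^ 2 + 2 * L + 1) := by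
      refine (mul_le_mul_of_nonneg_left (?_ : _ ≤ 3 / 2 * μ ^ 2 + 2 * L + 1)
        (Real.exp_pos _).le).trans ?_
      · linarith
      · gcongr
    linarith
  · have hs := hv.2.1 s hs0 hsT
    have e1 := (abs_le.1 (hFL s hs0 hsT)).1
    refine (integral_H2_energy_le hγ hε hε1 (hv.periodicJet hs0 hsT)
      (hv.periodicJet_deriv hξ hη hs0 hsT) (hξ.periodicJet hs0 hsT) (hη.periodicJet hs0 hsT)
      (hv.equation hξ hs0 hsT) ?_ ?_ (hM s hs0 hsT) hM1
      (fun x => (hξ.abs_iteratedDeriv_le (by norm_num) hs0 hsT x).trans hξB)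
      (fun x => (hξ.abs_iteratedDeriv_le (by norm_num) hs0 hsT x).trans hξB)
      (fun x => (hξ.abs_iteratedDeriv_le (by norm_num) hs0 hsT x).trans hξB)
      (fun x => (hη.abs_iteratedDeriv_le (by norm_num) hs0 hsT x).trans hηB)
      (hη.2.2 s hs0 hsT)).trans ?_
    · intro x
      simpa only [iteratedDeriv_zero, iteratedDeriv_one] using hs.sq_le x
    · intro x
      simpa only [iteratedDeriv_succ (n := 1)] using (hs.iteratedDeriv 1).sq_le x
    · have e2 : K * (1 + Hnorm 2 (v s) ^ 2) ≤ K * (2 * (F s + (L + 1))) := by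
        gcongr
        linarith
      change K * (1 + Hnorm 2 (v s) ^ 2) - ε / 2 * Hnorm 4 (v s) ^ 2 ≤ _
      linarith

end Solutions

/-- uniform-in-`ε` `H²` a priori bound for the parabolic regularization. -/
theorem reg_H2_apriori (γ T μ ρ ν : ℝ)
    (hγ : 0 < γ) (hT : 0 < T) (hμ : 0 < μ) (hρ : 0 < ρ) (hν : 0 < ν) :
    ∃ C : ℝ, 1 ≤ C ∧
      ∀ ε : ℝ, 0 < ε → ε ≤ 1 →
        ∀ ξ η v : ℝ → ℝ → ℝ,
          RegData T 5 ρ ξ → RegData T 2 ν η →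
          IsRegSol γ ε T ξ η v → L2norm (v 0) + Hnorm 2 (v 0) ≤ μ →
          ∀ t : ℝ, 0 ≤ t → t ≤ T →
            Hnorm 2 (v t)
              + Real.sqrt ε * Real.sqrt (∫ s in (0:ℝ)..T, (Hnorm 4 (v s)) ^ 2) ≤ C := by
  set B := (4 * Real.pi) ^ 5 * ρ + (4 * Real.pi) ^ 2 * ν with hB
  have hξB : (4 * Real.pi) ^ 5 * ρ ≤ B := le_add_of_nonneg_right (by positivity)
  have hηB : (4 * Real.pi) ^ 2 * ν ≤ B := le_add_of_nonneg_left (by positivity)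
  have hB0 : 0 ≤ B := by positivity
  set M := √(Real.exp ((1 + B + B ^ 2) * T) * (μ ^ 2 + 1)) with hM
  have hM1 : 1 ≤ M := Real.one_le_sqrt.2 (one_le_mul_of_one_le_of_one_le
    (Real.one_le_exp (by positivity)) (by nlinarith))
  obtain ⟨R, hR, h⟩ := exists_H2_energy_bound (ρ := ρ) (ν := ν) T μ hγ.le hB0 hM1
  refine ⟨1 + 2 * √R, by linarith [Real.sqrt_nonneg R], ?_⟩
  intro ε hε hε1 ξ η v hξ hη hv hv0 t h0 hT'
  have n0 : 0 ≤ L2norm (v 0) := L2norm_nonneg _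
  have n2 : 0 ≤ Hnorm 2 (v 0) := L2norm_nonneg _
  have hL2 : ∀ s, 0 ≤ s → s ≤ T → L2norm (v s) ≤ M := fun s hs0 hsT =>
    Real.le_sqrt_of_sq_le (by
      linarith [hv.L2norm_sq_le hγ.le hε.le hB0 hξ hη hξB hηB (by linarith : L2norm (v 0) ≤ μ)
        hs0 hsT])
  have hb := h ε hε hε1 ξ η v hξ hη hv hξB hηB hL2 (by linarith)
  have hint : ∀ s, 0 ≤ s → 0 ≤ ε * ∫ r in (0 : ℝ)..s, Hnorm 4 (v r) ^ 2 := fun s hs =>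
    mul_nonneg hε.le (intervalIntegral.integral_nonneg hs fun _ _ => sq_nonneg _)
  have e1 : Hnorm 2 (v t) ≤ √R :=
    Real.le_sqrt_of_sq_le (by linarith [hb t h0 hT', hint t h0])
  have e2 : √ε * √(∫ s in (0 : ℝ)..T, Hnorm 4 (v s) ^ 2) ≤ √R := by
    rw [← Real.sqrt_mul hε.le]
    exact Real.sqrt_le_sqrt (by linarith [hb T hT.le le_rfl, sq_nonneg (Hnorm 2 (v T))])
  linarith
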